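/- arXiv:math/0108120 — 3 statements merged into one kernel-verified Lean document; each statement's English description precedes it below -/
import Mathlib

section
/- Let d ≥ 1 and β > 0. There exists a constant b_* = b_*(β) > 0 such that for every δ > 0 and every 0 < b < b_*, as n → ∞, E₀(e^{−β J_n} · 1{J_n ≤ n^{1−δ}}) = o(E₀(e^{−β J_n} · 1{J_n < b n})); that is, the ratio of the left-hand side to the right-hand side tends to 0. -/
open Filter

/-- A single step in `ℤ^d`: a coordinate direction together with a sign,
so that there are exactly `2d` possible steps. -/
def stepVec (d : ℕ) (s : Fin d × Bool) (k : Fin d) : ℤ :=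
  if k = s.1 then (if s.2 then 1 else -1) else 0

/-- An `n`-step nearest-neighbour path in `ℤ^d` starting at the origin,
encoded by its sequence of steps. -/
abbrev Walk (d n : ℕ) := Fin n → Fin d × Bool

/-- The position `S(i)` of the walk after `i` steps. -/
def walkPos {d n : ℕ} (w : Walk d n) (i : ℕ) : Fin d → ℤ :=
  fun k => ∑ j ∈ Finset.filter (fun j : Fin n => (j : ℕ) < i) Finset.univ, stepVec d (w j) k

/-- The self-intersection local time `J_n = #{(i,j) : 0 ≤ i < j ≤ n, S(i) = S(j)}`. -/
def silt {d n : ℕ} (w : Walk d n) : ℕ :=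
  (((Finset.range (n+1)) ×ˢ (Finset.range (n+1))).filter
    (fun p => p.1 < p.2 ∧ walkPos w p.1 = walkPos w p.2)).card

/-- The Euclidean distance `χ_n = ‖S(n)‖₂` of the endpoint from the origin. -/
noncomputable def chi {d n : ℕ} (w : Walk d n) : ℝ :=
  Real.sqrt (∑ k : Fin d, ((walkPos w n k : ℝ))^2)

/-- Expectation `E₀` under the uniform measure on the `(2d)^n` `n`-step paths. -/
noncomputable def E0 (d n : ℕ) (f : Walk d n → ℝ) : ℝ :=
  (∑ w : Walk d n, f w) / ((2*d : ℝ))^n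

/-- Expectation `E_β` with respect to the weakly self-avoiding walk measure
`Q_n^β(A) = E₀(e^{-β J_n} 1_A)/E₀(e^{-β J_n})`. -/
noncomputable def Ewsaw (d n : ℕ) (β : ℝ) (f : Walk d n → ℝ) : ℝ :=
  (∑ w : Walk d n, Real.exp (-β * (silt w : ℝ)) * f w) /
    (∑ w : Walk d n, Real.exp (-β * (silt w : ℝ)))

/-- The exponent `μ(d)`: `μ(1) = 1` and `μ(d) = max(1/2, 1/4 + 1/d)` for `d ≥ 2`. -/
noncomputable def mu (d : ℕ) : ℝ :=
  if d = 1 then 1 else max (1/2) (1/4 + 1/(d : ℝ))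

theorem walkPos_succ {d n : ℕ} (w : Walk d n) (j : ℕ) (hj : j < n) :
    walkPos w (j + 1) = walkPos w j + stepVec d (w ⟨j, hj⟩) := by
  funext k
  have h : Finset.filter (fun l : Fin n => (l : ℕ) < j + 1) Finset.univ
      = insert ⟨j, hj⟩ (Finset.filter (fun l : Fin n => (l : ℕ) < j) Finset.univ) := by
    ext l
    simp only [Finset.mem_filter, Finset.mem_univ, true_and, Finset.mem_insert, Fin.ext_iff]
    omega
  simp only [walkPos, Pi.add_apply, h]
  rw [Finset.sum_insert (by simp), add_comm]

theorem stepVec_not (d : ℕ) (s : Fin d × Bool) :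
    stepVec d (s.1, !s.2) = -stepVec d s := by
  funext k
  rcases s with ⟨a, _ | _⟩ <;> by_cases h : k = a <;> simp [stepVec, h]

/-- The walk obtained from `w` by inserting, after step `i`, the reverse of step `i` followed by
step `i` again, and deleting the last two steps. -/
def insertBacktrack {d n : ℕ} (w : Walk d n) (i : ℕ) : Walk d n := fun j =>
  if (j : ℕ) ≤ i then w j
  else if (j : ℕ) = i + 1 then ((w ⟨j - 1, by omega⟩).1, !(w ⟨j - 1, by omega⟩).2)
  else w ⟨j - 2, by omega⟩

/-- The time of the original walk corresponding to time `j` of the walk `insertBacktrack w i`. -/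
def backtrackTime (i j : ℕ) : ℕ := if j ≤ i + 1 then j else j - 2

theorem walkPos_insertBacktrack {d n : ℕ} (w : Walk d n) (i j : ℕ) (hj : j ≤ n) :
    walkPos (insertBacktrack w i) j = walkPos w (backtrackTime i j) := by
  induction j with
  | zero =>
    funext k
    simp [walkPos, backtrackTime]
  | succ j ih =>
    rw [walkPos_succ _ j hj, ih (by omega)]
    rcases lt_trichotomy j (i + 1) with h | h | h
    · have h1 : backtrackTime i j = j := if_pos (by omega)
      have h2 : backtrackTime i (j + 1) = j + 1 := if_pos (by omega)
      rw [h1, h2, walkPos_succ _ j hj]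
      simp [insertBacktrack, Nat.lt_succ_iff.mp h]
    · subst h
      have h1 : backtrackTime i (i + 1) = i + 1 := if_pos le_rfl
      have h2 : backtrackTime i (i + 1 + 1) = i := if_neg (by omega)
      rw [h1, h2, walkPos_succ w i (by omega)]
      simp [insertBacktrack, stepVec_not]
    · have h1 : backtrackTime i j = j - 2 := if_neg (by omega)
      have h2 : backtrackTime i (j + 1) = j - 2 + 1 :=
        (if_neg (by omega)).trans (by omega)
      rw [h1, h2, walkPos_succ w (j - 2) (by omega)]
      have h3 : ¬ j ≤ i := by omega
      have h4 : j ≠ i + 1 := by omega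
      simp [insertBacktrack, h3, h4]

/-- The site visited at time `i` is visited at no other time. -/
def VisitedOnce {d n : ℕ} (w : Walk d n) (i : ℕ) : Prop :=
  ∀ j ≤ n, walkPos w i = walkPos w j → j = i

theorem silt_insertBacktrack_le {d n : ℕ} (w : Walk d n) (i : ℕ)
    (h0 : VisitedOnce w i) (h1 : VisitedOnce w (i + 1)) :
    silt (insertBacktrack w i) ≤ silt w + 2 := by
  unfold silt
  set P := ((Finset.range (n + 1)) ×ˢ (Finset.range (n + 1))).filter
    (fun p => p.1 < p.2 ∧ walkPos (insertBacktrack w i) p.1 = walkPos (insertBacktrack w i) p.2)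
    with hP
  have hmem : ∀ p ∈ P, p ≠ (i, i + 2) → p ≠ (i + 1, i + 3) →
      p.1 < p.2 ∧ p.2 ≤ n ∧
      walkPos w (backtrackTime i p.1) = walkPos w (backtrackTime i p.2) ∧
      (p.1 < i ∨ i + 4 ≤ p.1) ∧ (p.2 < i ∨ i + 4 ≤ p.2) := by
    rintro ⟨p, q⟩ hp hne0 hne1
    simp only [hP, Finset.mem_filter, Finset.mem_product, Finset.mem_range] at hp
    obtain ⟨⟨hpn, hqn⟩, hlt, he⟩ := hp
    rw [walkPos_insertBacktrack _ _ _ (by omega), walkPos_insertBacktrack _ _ _ (by omega)] at he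
    simp only [ne_eq, Prod.mk.injEq] at hne0 hne1
    have a0 : backtrackTime i p = i → backtrackTime i q = i := fun h =>
      h0 _ (by unfold backtrackTime; split <;> omega) ((congrArg (walkPos w) h).symm.trans he)
    have a1 : backtrackTime i q = i → backtrackTime i p = i := fun h =>
      h0 _ (by unfold backtrackTime; split <;> omega) ((congrArg (walkPos w) h).symm.trans he.symm)
    have b0 : backtrackTime i p = i + 1 → backtrackTime i q = i + 1 := fun h =>
      h1 _ (by unfold backtrackTime; split <;> omega) ((congrArg (walkPos w) h).symm.trans he)
    have b1 : backtrackTime i q = i + 1 → backtrackTime i p = i + 1 := fun h =>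
      h1 _ (by unfold backtrackTime; split <;> omega) ((congrArg (walkPos w) h).symm.trans he.symm)
    refine ⟨hlt, by omega, he, ?_⟩
    unfold backtrackTime at a0 a1 b0 b1
    split_ifs at a0 a1 b0 b1 <;> omega
  have hcard : (P \ {(i, i + 2), (i + 1, i + 3)}).card ≤
      (((Finset.range (n + 1)) ×ˢ (Finset.range (n + 1))).filter
        (fun p => p.1 < p.2 ∧ walkPos w p.1 = walkPos w p.2)).card := by
    refine Finset.card_le_card_of_injOn
      (fun p => (backtrackTime i p.1, backtrackTime i p.2)) ?_ ?_
    · intro p hp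
      simp only [Finset.coe_sdiff, Finset.coe_insert, Finset.coe_singleton, Set.mem_sdiff,
        Finset.mem_coe, Set.mem_insert_iff, Set.mem_singleton_iff, not_or] at hp
      obtain ⟨k1, k2, k3, k4, k5⟩ := hmem p hp.1 hp.2.1 hp.2.2
      simp only [Finset.coe_filter, Set.mem_ofPred_eq, Finset.mem_product, Finset.mem_range]
      refine ⟨⟨?_, ?_⟩, ?_, k3⟩ <;> unfold backtrackTime <;> split_ifs <;> omega
    · intro p hp q hq hpq
      simp only [Finset.coe_sdiff, Finset.coe_insert, Finset.coe_singleton, Set.mem_sdiff,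
        Finset.mem_coe, Set.mem_insert_iff, Set.mem_singleton_iff, not_or] at hp hq
      obtain ⟨k1, k2, k3, k4, k5⟩ := hmem p hp.1 hp.2.1 hp.2.2
      obtain ⟨l1, l2, l3, l4, l5⟩ := hmem q hq.1 hq.2.1 hq.2.2
      simp only [Prod.mk.injEq, backtrackTime] at hpq
      obtain ⟨e1, e2⟩ := hpq
      ext
      · split_ifs at e1 <;> omega
      · split_ifs at e2 <;> omega
  have h2 : ({(i, i + 2), (i + 1, i + 3)} : Finset (ℕ × ℕ)).card ≤ 2 := Finset.card_le_two
  have h3 := Finset.le_card_sdiff ({(i, i + 2), (i + 1, i + 3)} : Finset (ℕ × ℕ)) P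
  omega

open Classical in
theorem card_not_visitedOnce_le {d n : ℕ} (w : Walk d n) :
    ((Finset.range (n + 1)).filter (fun i => ¬ VisitedOnce w i)).card ≤ 2 * silt w := by
  unfold silt
  set P := ((Finset.range (n + 1)) ×ˢ (Finset.range (n + 1))).filter
    (fun p => p.1 < p.2 ∧ walkPos w p.1 = walkPos w p.2) with hP
  have hsub : (Finset.range (n + 1)).filter (fun i => ¬ VisitedOnce w i) ⊆
      P.image Prod.fst ∪ P.image Prod.snd := by
    intro i hi
    simp only [Finset.mem_filter, Finset.mem_range, VisitedOnce, not_forall] at hi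
    obtain ⟨hin, j, hj, he, hne⟩ := hi
    rw [Finset.mem_union, Finset.mem_image, Finset.mem_image]
    rcases lt_or_gt_of_ne hne with h | h
    · refine Or.inr ⟨(j, i), ?_, rfl⟩
      simp only [hP, Finset.mem_filter, Finset.mem_product, Finset.mem_range]
      exact ⟨⟨by omega, hin⟩, h, he.symm⟩
    · refine Or.inl ⟨(i, j), ?_, rfl⟩
      simp only [hP, Finset.mem_filter, Finset.mem_product, Finset.mem_range]
      exact ⟨⟨hin, by omega⟩, h, he⟩
  calc _ ≤ (P.image Prod.fst ∪ P.image Prod.snd).card := Finset.card_le_card hsub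
    _ ≤ (P.image Prod.fst).card + (P.image Prod.snd).card := Finset.card_union_le _ _
    _ ≤ 2 * P.card := by
        have := Finset.card_image_le (s := P) (f := Prod.fst)
        have := Finset.card_image_le (s := P) (f := Prod.snd)
        omega

open Classical in
/-- The times `i` such that the `i`-th step joins two sites visited only once. -/
noncomputable def freeSteps {d n : ℕ} (w : Walk d n) : Finset ℕ :=
  (Finset.range (n - 1)).filter (fun i => VisitedOnce w i ∧ VisitedOnce w (i + 1))

theorem le_card_freeSteps {d n : ℕ} (w : Walk d n) :
    n ≤ (freeSteps w).card + 4 * silt w + 1 := by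
  classical
  have hB := card_not_visitedOnce_le w
  set B := (Finset.range (n + 1)).filter (fun i => ¬ VisitedOnce w i) with hBdef
  have hsub : Finset.range (n - 1) ⊆ freeSteps w ∪ (B ∪ B.image (fun k => k - 1)) := by
    intro i hi
    rw [Finset.mem_range] at hi
    simp only [freeSteps, Finset.mem_union, Finset.mem_filter, Finset.mem_range, Finset.mem_image,
      hBdef]
    by_cases h0 : VisitedOnce w i
    · by_cases h1 : VisitedOnce w (i + 1)
      · exact Or.inl ⟨hi, h0, h1⟩
      · exact Or.inr (Or.inr ⟨i + 1, ⟨by omega, h1⟩, rfl⟩)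
    · exact Or.inr (Or.inl ⟨by omega, h0⟩)
  have h1 := Finset.card_le_card hsub
  rw [Finset.card_range] at h1
  have h2 := Finset.card_union_le (freeSteps w) (B ∪ B.image (fun k => k - 1))
  have h3 := Finset.card_union_le B (B.image (fun k => k - 1))
  have h4 := Finset.card_image_le (s := B) (f := fun k => k - 1)
  omega

/-- The times at which the walk is about to step forth and back. -/
def backtracks {d n : ℕ} (w : Walk d n) : Finset ℕ :=
  (Finset.range (n - 1)).filter (fun i => walkPos w i = walkPos w (i + 2))

theorem card_backtracks_le {d n : ℕ} (w : Walk d n) : (backtracks w).card ≤ silt w := by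
  refine Finset.card_le_card_of_injOn (fun i => (i, i + 2)) ?_ ?_
  · intro i hi
    simp only [backtracks, Finset.coe_filter, Finset.mem_range, Set.mem_ofPred_eq] at hi
    simp only [Finset.coe_filter, Set.mem_ofPred_eq, Finset.mem_product, Finset.mem_range]
    exact ⟨⟨by omega, by omega⟩, by omega, hi.2⟩
  · intro i _ j _ h
    exact (Prod.mk.inj h).1

theorem mem_backtracks_insertBacktrack {d n : ℕ} (w : Walk d n) (i : ℕ) (hi : i < n - 1) :
    i ∈ backtracks (insertBacktrack w i) := by
  simp only [backtracks, Finset.mem_filter, Finset.mem_range]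
  refine ⟨hi, ?_⟩
  rw [walkPos_insertBacktrack _ _ _ (by omega), walkPos_insertBacktrack _ _ _ (by omega)]
  simp [backtrackTime]

theorem insertBacktrack_injective {d n : ℕ} {w v : Walk d n} {i : ℕ}
    (h : insertBacktrack w i = insertBacktrack v i)
    (hlast : ∀ j : Fin n, n ≤ j + 2 → w j = v j) : w = v := by
  funext j
  by_cases hj : n ≤ j + 2
  · exact hlast j hj
  · by_cases hji : (j : ℕ) ≤ i
    · simpa [insertBacktrack, hji] using congrFun h j
    · have h1 : ¬ (j : ℕ) + 2 ≤ i := by omega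
      have h2 : (j : ℕ) + 2 ≠ i + 1 := by omega
      simpa [insertBacktrack, h1, h2] using congrFun h ⟨j + 2, by omega⟩

theorem sum_mul_le_of_injective {α ι κ : Type*} [Fintype κ] (A B : Finset α)
    (G I : α → Finset ι) (φ : α → ι → α) (τ : α → κ) (f : α → ℝ) (a c C : ℝ)
    (hf : ∀ w, 0 ≤ f w) (hC : 0 ≤ C)
    (hmap : ∀ w ∈ A, ∀ i ∈ G w, φ w i ∈ B ∧ i ∈ I (φ w i))
    (hinj : ∀ w v i, φ w i = φ v i → τ w = τ v → w = v)
    (hle : ∀ w ∈ A, ∀ i ∈ G w, f w ≤ C * f (φ w i))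
    (hG : ∀ w ∈ A, a ≤ (G w).card) (hI : ∀ w ∈ B, ((I w).card : ℝ) ≤ c) :
    a * ∑ w ∈ A, f w ≤ C * c * Fintype.card κ * ∑ w ∈ B, f w := by
  classical
  set Φ : (Σ _ : α, ι) → (Σ _ : α, ι × κ) := fun x => ⟨φ x.1 x.2, x.2, τ x.1⟩ with hΦ
  have hΦinj : Function.Injective Φ := by
    rintro ⟨w, i⟩ ⟨v, j⟩ h
    simp only [hΦ, Sigma.mk.injEq, heq_eq_eq, Prod.mk.injEq] at h
    obtain ⟨h1, rfl, h3⟩ := h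
    rw [hinj w v i h1 h3]
  calc a * ∑ w ∈ A, f w ≤ ∑ w ∈ A, ∑ _i ∈ G w, f w := by
        rw [Finset.mul_sum]
        refine Finset.sum_le_sum fun w hw => ?_
        rw [Finset.sum_const, nsmul_eq_mul]
        exact mul_le_mul_of_nonneg_right (hG w hw) (hf w)
    _ = ∑ x ∈ A.sigma G, f x.1 := by rw [Finset.sum_sigma]
    _ ≤ ∑ x ∈ A.sigma G, C * f (Φ x).1 := by
        refine Finset.sum_le_sum fun x hx => ?_
        rw [Finset.mem_sigma] at hx
        exact hle _ hx.1 _ hx.2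
    _ = ∑ y ∈ (A.sigma G).image Φ, C * f y.1 := by
        rw [Finset.sum_image hΦinj.injOn]
    _ ≤ ∑ y ∈ B.sigma (fun w => I w ×ˢ (Finset.univ : Finset κ)), C * f y.1 := by
        refine Finset.sum_le_sum_of_subset_of_nonneg ?_ fun y _ _ => mul_nonneg hC (hf _)
        intro y hy
        obtain ⟨x, hx, rfl⟩ := Finset.mem_image.mp hy
        rw [Finset.mem_sigma] at hx
        have := hmap _ hx.1 _ hx.2
        simp [hΦ, this.1, this.2]
    _ = ∑ w ∈ B, C * (((I w).card : ℝ) * Fintype.card κ * f w) := by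
        rw [Finset.sum_sigma]
        refine Finset.sum_congr rfl fun w _ => ?_
        simp only [Finset.sum_const, Finset.card_product, Finset.card_univ, nsmul_eq_mul,
          Nat.cast_mul]
        ring
    _ ≤ ∑ w ∈ B, C * (c * Fintype.card κ * f w) := by
        refine Finset.sum_le_sum fun w hw => ?_
        have := hf w
        have := hI w hw
        gcongr
    _ = C * c * Fintype.card κ * ∑ w ∈ B, f w := by
        rw [Finset.mul_sum]
        exact Finset.sum_congr rfl fun w _ => by ring

theorem E0_silt_le (d n : ℕ) (hn : 2 ≤ n) (β : ℝ) (hβ : 0 < β) (m M : ℝ) (hm : 0 ≤ m)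
    (hmM : m + 2 < M) :
    (n - 1 - 4 * m) * E0 d n (fun w => Real.exp (-β * (silt w : ℝ)) *
        (if (silt w : ℝ) ≤ m then 1 else 0)) ≤
      Real.exp (2 * β) * (m + 2) * (2 * d) ^ 2 *
        E0 d n (fun w => Real.exp (-β * (silt w : ℝ)) *
          (if (silt w : ℝ) < M then 1 else 0)) := by
  classical
  set f : Walk d n → ℝ := fun w => Real.exp (-β * (silt w : ℝ)) with hf
  have hsilt : ∀ w : Walk d n, ∀ i ∈ freeSteps w,
      (silt (insertBacktrack w i) : ℝ) ≤ silt w + 2 := by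
    intro w i hi
    simp only [freeSteps, Finset.mem_filter] at hi
    exact_mod_cast silt_insertBacktrack_le w i hi.2.1 hi.2.2
  have key := sum_mul_le_of_injective
    (Finset.univ.filter fun w : Walk d n => (silt w : ℝ) ≤ m)
    (Finset.univ.filter fun w : Walk d n => (silt w : ℝ) ≤ m + 2)
    freeSteps backtracks insertBacktrack
    (fun w => (w ⟨n - 2, by omega⟩, w ⟨n - 1, by omega⟩)) f
    (n - 1 - 4 * m) (m + 2) (Real.exp (2 * β)) (fun w => (Real.exp_pos _).le)
    (Real.exp_pos _).le ?_ ?_ ?_ ?_ ?_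
  · have hcard : (Fintype.card ((Fin d × Bool) × (Fin d × Bool)) : ℝ) = (2 * d) ^ 2 := by
      simp only [Fintype.card_prod, Fintype.card_fin, Fintype.card_bool]
      push_cast
      ring
    rw [hcard] at key
    have hA : ∑ w : Walk d n, f w * (if (silt w : ℝ) ≤ m then 1 else 0) =
        ∑ w ∈ Finset.univ.filter (fun w : Walk d n => (silt w : ℝ) ≤ m), f w := by
      simp [Finset.sum_filter]
    have hB : ∑ w ∈ Finset.univ.filter (fun w : Walk d n => (silt w : ℝ) ≤ m + 2), f w ≤
        ∑ w : Walk d n, f w * (if (silt w : ℝ) < M then 1 else 0) := by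
      rw [Finset.sum_filter]
      refine Finset.sum_le_sum fun w _ => ?_
      have hw : 0 ≤ f w := (Real.exp_pos _).le
      by_cases h : (silt w : ℝ) ≤ m + 2
      · simp [h, h.trans_lt hmM]
      · rw [if_neg h]
        positivity
    simp only [E0]
    rw [← mul_div_assoc, ← mul_div_assoc]
    refine div_le_div_of_nonneg_right ?_ (by positivity)
    rw [hA]
    exact key.trans (mul_le_mul_of_nonneg_left hB (by positivity))
  · intro w hw i hi
    rw [Finset.mem_filter] at hw ⊢
    have h := hsilt w i hi
    simp only [freeSteps, Finset.mem_filter, Finset.mem_range] at hi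
    exact ⟨⟨Finset.mem_univ _, by linarith [hw.2]⟩, mem_backtracks_insertBacktrack w i hi.1⟩
  · intro w v i h hτ
    simp only [Prod.mk.injEq] at hτ
    refine insertBacktrack_injective h fun j hj => ?_
    have hjn := j.isLt
    rcases (by omega : (j : ℕ) = n - 2 ∨ (j : ℕ) = n - 1) with e | e
    · rw [show j = ⟨n - 2, by omega⟩ from Fin.ext e]
      exact hτ.1
    · rw [show j = ⟨n - 1, by omega⟩ from Fin.ext e]
      exact hτ.2
  · intro w hw i hi
    rw [hf, ← Real.exp_add]
    refine Real.exp_le_exp.mpr ?_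
    have := mul_le_mul_of_nonneg_left (hsilt w i hi) hβ.le
    linarith
  · intro w hw
    have h1 : (n : ℝ) ≤ (freeSteps w).card + 4 * silt w + 1 := by
      exact_mod_cast le_card_freeSteps w
    have h2 := (Finset.mem_filter.mp hw).2
    linarith
  · intro w hw
    have h1 : ((backtracks w).card : ℝ) ≤ silt w := by exact_mod_cast card_backtracks_le w
    exact h1.trans (Finset.mem_filter.mp hw).2

/-- lower bound for `J_n`.  There is `b_* = b_*(β) > 0` such that
for every `δ > 0` and every `0 < b < b_*`,
`E₀(e^{-βJ_n} 1{J_n ≤ n^{1-δ}}) = o(E₀(e^{-βJ_n} 1{J_n < bn}))` as `n → ∞`. -/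
theorem silt_lower_bound (d : ℕ) (hd : 1 ≤ d) (β : ℝ) (hβ : 0 < β) :
    ∃ bstar : ℝ, 0 < bstar ∧
      ∀ δ : ℝ, 0 < δ → ∀ b : ℝ, 0 < b → b < bstar →
        Filter.Tendsto
          (fun n : ℕ =>
            E0 d n (fun w => Real.exp (-β * (silt w : ℝ)) *
                (if (silt w : ℝ) ≤ (n : ℝ) ^ ((1 : ℝ) - δ) then 1 else 0)) /
            E0 d n (fun w => Real.exp (-β * (silt w : ℝ)) *
                (if (silt w : ℝ) < b * n then 1 else 0)))
          Filter.atTop (nhds 0) := by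
  refine ⟨1, one_pos, fun δ hδ b hb _ => ?_⟩
  have hE : ∀ (n : ℕ) (p : Walk d n → Prop) [DecidablePred p],
      0 ≤ E0 d n (fun w => Real.exp (-β * (silt w : ℝ)) * (if p w then 1 else 0)) := by
    intro n p _
    unfold E0
    refine div_nonneg (Finset.sum_nonneg fun w _ => ?_) (by positivity)
    positivity
  have hinv : Tendsto (fun n : ℕ => ((n : ℝ))⁻¹) atTop (nhds 0) :=
    tendsto_inv_atTop_nhds_zero_nat
  have hpow : Tendsto (fun n : ℕ => (n : ℝ) ^ (1 - δ) / n) atTop (nhds 0) := by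
    refine ((tendsto_rpow_neg_atTop hδ).comp tendsto_natCast_atTop_atTop).congr' ?_
    filter_upwards [eventually_gt_atTop 0] with n hn
    have hn' : (0 : ℝ) < n := by exact_mod_cast hn
    rw [Function.comp_apply, ← Real.rpow_sub_one hn'.ne']
    congr 1
    ring
  have hnum : Tendsto (fun n : ℕ => (n : ℝ) ^ (1 - δ) / n + 2 * (n : ℝ)⁻¹) atTop (nhds 0) := by
    simpa using hpow.add (hinv.const_mul 2)
  have hden : Tendsto (fun n : ℕ => 1 - (n : ℝ)⁻¹ - 4 * ((n : ℝ) ^ (1 - δ) / n)) atTop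
      (nhds 1) := by
    simpa using (tendsto_const_nhds.sub hinv).sub (hpow.const_mul 4)
  have hbound : Tendsto (fun n : ℕ => Real.exp (2 * β) * (2 * d) ^ 2 *
      (((n : ℝ) ^ (1 - δ) / n + 2 * (n : ℝ)⁻¹) /
        (1 - (n : ℝ)⁻¹ - 4 * ((n : ℝ) ^ (1 - δ) / n)))) atTop (nhds 0) := by
    simpa using (hnum.div hden one_ne_zero).const_mul (Real.exp (2 * β) * (2 * d) ^ 2)
  refine squeeze_zero' (Eventually.of_forall fun n => div_nonneg (hE n _) (hE n _)) ?_ hbound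
  filter_upwards [eventually_ge_atTop 2, hnum.eventually_lt_const hb,
    hden.eventually_const_lt one_pos] with n hn h1 h2
  have hn' : (0 : ℝ) < n := by exact_mod_cast (by omega : 0 < n)
  set m : ℝ := (n : ℝ) ^ (1 - δ) with hmdef
  have hm : 0 ≤ m := by positivity
  have e1 : m / n + 2 * (n : ℝ)⁻¹ = (m + 2) / n := by field_simp
  have e2 : 1 - (n : ℝ)⁻¹ - 4 * (m / n) = (n - 1 - 4 * m) / n := by field_simp
  rw [e1, div_lt_iff₀ hn'] at h1
  rw [e2] at h2
  have h3 : 0 < n - 1 - 4 * m := (div_pos_iff_of_pos_right hn').mp h2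
  rw [e1, e2, div_div_div_cancel_right₀ hn'.ne', ← mul_div_assoc]
  refine div_le_of_le_mul₀ (hE n _) (by positivity) ?_
  rw [div_mul_eq_mul_div, le_div_iff₀ h3]
  linarith [E0_silt_le d n hn β hβ m (b * n) hm h1]
end

section
/- For the simple random walk in Z (dimension d = 1), the expected self-intersection local time satisfies E₀(J_n) = (c + o(1)) · n^{3/2} as n → ∞ for some explicit positive constant c; in particular the limit lim_{n→∞} E₀(J_n)/n^{3/2} exists and is a positive real number. -/
open Filter

/-- The return probability `C(2m, m) / 4^m` of simple random walk in `ℤ` after `2m` steps. -/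
noncomputable def returnProb (m : ℕ) : ℝ := (m.centralBinom : ℝ) / 4 ^ m

theorem returnProb_zero : returnProb 0 = 1 := by simp [returnProb]

theorem returnProb_nonneg (m : ℕ) : 0 ≤ returnProb m := by
  unfold returnProb; positivity

theorem returnProb_succ (m : ℕ) :
    (2 * (m : ℝ) + 2) * returnProb (m + 1) = (2 * m + 1) * returnProb m := by
  have h : ((m : ℝ) + 1) * (m + 1).centralBinom = 2 * (2 * m + 1) * m.centralBinom := by
    exact_mod_cast Nat.succ_mul_centralBinom_succ m
  unfold returnProb
  rw [pow_succ]
  field_simp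
  linear_combination 2 * h

/-- The probability that simple random walk in `ℤ` is at its starting point after `l` steps. -/
noncomputable def returnProbAt (l : ℕ) : ℝ := if Even l then returnProb (l / 2) else 0

theorem sum_returnProbAt (j : ℕ) :
    ∑ l ∈ Finset.range (j + 1), returnProbAt l =
      (2 * ((j / 2 : ℕ) : ℝ) + 1) * returnProb (j / 2) := by
  induction j with
  | zero => simp [returnProbAt, returnProb_zero]
  | succ j ih =>
    rw [Finset.sum_range_succ, ih, returnProbAt]
    obtain ⟨k, rfl | rfl⟩ := j.even_or_odd'
    · have h1 : (2 * k + 1) / 2 = k := by lia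
      have h2 : ¬ Even (2 * k + 1) := by simp
      simp [h1, h2]
    · have h1 : (2 * k + 1) / 2 = k := by lia
      have h2 : (2 * k + 1 + 1) / 2 = k + 1 := by lia
      have h3 : Even (2 * k + 1 + 1) := ⟨k + 1, by ring⟩
      rw [h1, h2, if_pos h3]
      push_cast
      linear_combination -returnProb_succ k

theorem sum_mul_returnProb (n : ℕ) :
    ∑ j ∈ Finset.range (n + 1), (2 * ((j / 2 : ℕ) : ℝ) + 1) * returnProb (j / 2) =
      (2 * ((n / 2 : ℕ) : ℝ) + 1) * returnProb (n / 2) * (n + 1 - 2 * ((n / 2 : ℕ) : ℝ) / 3) := by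
  induction n with
  | zero => simp [returnProb_zero]
  | succ n ih =>
    rw [Finset.sum_range_succ, ih]
    obtain ⟨k, rfl | rfl⟩ := n.even_or_odd'
    · have h1 : (2 * k + 1) / 2 = k := by lia
      have h2 : 2 * k / 2 = k := by lia
      rw [h1, h2]
      push_cast
      ring
    · have h1 : (2 * k + 1) / 2 = k := by lia
      have h2 : (2 * k + 1 + 1) / 2 = k + 1 := by lia
      rw [h1, h2]
      push_cast
      linear_combination -(2 * (2 * (k : ℝ) + 3) / 3) * returnProb_succ k

theorem sum_returnProbAt_sub (n : ℕ) :
    ∑ j ∈ Finset.range (n + 1), ∑ i ∈ Finset.range j, returnProbAt (j - i) =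
      (2 * ((n / 2 : ℕ) : ℝ) + 1) * returnProb (n / 2) * (n + 1 - 2 * ((n / 2 : ℕ) : ℝ) / 3)
        - (n + 1) := by
  have h (j : ℕ) : ∑ i ∈ Finset.range j, returnProbAt (j - i) =
      (2 * ((j / 2 : ℕ) : ℝ) + 1) * returnProb (j / 2) - 1 := by
    have h0 : returnProbAt 0 = 1 := by simp [returnProbAt, returnProb_zero]
    rw [← sum_returnProbAt, Finset.sum_range_succ', h0, add_sub_cancel_right,
      ← Finset.sum_range_reflect (fun l => returnProbAt (l + 1))]
    refine Finset.sum_congr rfl fun i hi => ?_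
    rw [Finset.mem_range] at hi
    congr 1
    lia
  simp only [h, Finset.sum_sub_distrib, sum_mul_returnProb]
  simp

theorem card_filter_card_inter {α : Type*} [Fintype α] [DecidableEq α] (A : Finset α) (k : ℕ) :
    (Finset.univ.filter fun s : Finset α => (s ∩ A).card = k).card =
      A.card.choose k * 2 ^ Aᶜ.card := by
  rw [← Finset.card_powersetCard, ← Finset.card_powerset, ← Finset.card_product]
  refine Finset.card_nbij' (fun s => (s ∩ A, s ∩ Aᶜ)) (fun t => t.1 ∪ t.2) ?_ ?_ ?_ ?_
  · intro s hs
    simp_all [Finset.mem_powersetCard]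
  · rintro ⟨s, t⟩ h
    simp only [Finset.coe_product, Set.mem_prod, Finset.mem_coe, Finset.mem_powersetCard,
      Finset.mem_powerset] at h
    have : (s ∪ t) ∩ A = s := by grind [Finset.mem_compl]
    simp [this, h.1.2]
  · intro s _
    grind [Finset.mem_compl]
  · rintro ⟨s, t⟩ h
    simp only [Finset.coe_product, Set.mem_prod, Finset.mem_coe, Finset.mem_powersetCard,
      Finset.mem_powerset] at h
    ext x <;> grind [Finset.mem_compl]

/-- A one-dimensional walk is determined by its set of positive steps. -/
def walkEquivFinset (n : ℕ) : Walk 1 n ≃ Finset (Fin n) where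
  toFun w := Finset.univ.filter fun k => (w k).2
  invFun s k := (0, decide (k ∈ s))
  left_inv w := by
    funext k
    ext <;> simp
  right_inv s := by ext; simp

theorem walkPos_eq_iff {n i j : ℕ} (hij : i < j) (w : Walk 1 n) :
    walkPos w i = walkPos w j ↔
      2 * (walkEquivFinset n w ∩
        Finset.univ.filter fun k : Fin n => i ≤ (k : ℕ) ∧ (k : ℕ) < j).card =
      (Finset.univ.filter fun k : Fin n => i ≤ (k : ℕ) ∧ (k : ℕ) < j).card := by
  set A := Finset.univ.filter fun k : Fin n => i ≤ (k : ℕ) ∧ (k : ℕ) < j with hA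
  have hstep : ∑ k ∈ A, stepVec 1 (w k) 0 = 2 * ((walkEquivFinset n w ∩ A).card : ℤ) - A.card := by
    have h1 : walkEquivFinset n w ∩ A = A.filter fun k => (w k).2 := by
      ext; simp [walkEquivFinset, and_comm]
    rw [h1, Finset.card_filter, Finset.card_eq_sum_ones]
    push_cast
    rw [Finset.mul_sum, ← Finset.sum_sub_distrib]
    refine Finset.sum_congr rfl fun k _ => ?_
    have : (0 : Fin 1) = (w k).1 := Subsingleton.elim _ _
    rw [stepVec, if_pos this]
    split_ifs <;> simp
  have hsplit : walkPos w j 0 = walkPos w i 0 + ∑ k ∈ A, stepVec 1 (w k) 0 := by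
    unfold walkPos
    rw [← Finset.sum_union]
    · congr 1
      ext k
      simp [hA]
      lia
    · rw [Finset.disjoint_left]
      intro k
      simp [hA]
      lia
  have hfun : walkPos w i = walkPos w j ↔ walkPos w i 0 = walkPos w j 0 :=
    ⟨fun h => congrFun h 0, fun h => funext fun k => by rwa [Subsingleton.elim k 0]⟩
  rw [hfun, hsplit, hstep]
  lia

theorem card_walkPos_eq {n i j : ℕ} (hij : i < j) (hj : j ≤ n) :
    ((Finset.univ.filter fun w : Walk 1 n => walkPos w i = walkPos w j).card : ℝ) =
      2 ^ n * returnProbAt (j - i) := by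
  set A := Finset.univ.filter fun k : Fin n => i ≤ (k : ℕ) ∧ (k : ℕ) < j with hA
  have hcard : A.card = j - i := by
    rw [← Nat.card_Ico, ← Finset.card_map Fin.valEmbedding]
    congr 1
    ext x
    simp only [hA, Finset.mem_map, Finset.mem_filter, Finset.mem_univ, true_and,
      Fin.valEmbedding_apply, Finset.mem_Ico]
    exact ⟨by rintro ⟨k, hk, rfl⟩; exact hk, fun hx => ⟨⟨x, by lia⟩, hx, rfl⟩⟩
  have hcompl : Aᶜ.card = n - (j - i) := by rw [Finset.card_compl, hcard, Fintype.card_fin]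
  have htransfer : (Finset.univ.filter fun w : Walk 1 n => walkPos w i = walkPos w j).card =
      (Finset.univ.filter fun s : Finset (Fin n) => 2 * (s ∩ A).card = j - i).card := by
    refine Finset.card_equiv (walkEquivFinset n) fun w => ?_
    simp only [Finset.mem_filter, Finset.mem_univ, true_and]
    rw [walkPos_eq_iff hij, ← hA, hcard]
  rw [htransfer, returnProbAt]
  split_ifs with h
  · obtain ⟨k, hk⟩ := h
    have hk2 : (j - i) / 2 = k := by lia
    have hiff (s : Finset (Fin n)) : 2 * (s ∩ A).card = j - i ↔ (s ∩ A).card = k := by lia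
    simp only [hiff]
    rw [card_filter_card_inter, hcard, hcompl, hk2, hk, ← two_mul,
      ← Nat.centralBinom_eq_two_mul_choose, returnProb]
    have hpow : (2 : ℝ) ^ n = 2 ^ (n - 2 * k) * 4 ^ k := by
      rw [show (4 : ℝ) = 2 ^ 2 by norm_num, ← pow_mul, ← pow_add]
      congr 1
      lia
    rw [hpow]
    push_cast
    field_simp
  · rw [mul_zero, Nat.cast_eq_zero, Finset.card_eq_zero, Finset.filter_eq_empty_iff]
    intro s _ hs
    exact h ⟨(s ∩ A).card, by lia⟩

theorem E0_silt_one (n : ℕ) :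
    E0 1 n (fun w => (silt w : ℝ)) =
      (2 * ((n / 2 : ℕ) : ℝ) + 1) * returnProb (n / 2) * (n + 1 - 2 * ((n / 2 : ℕ) : ℝ) / 3)
        - (n + 1) := by
  have hsilt (w : Walk 1 n) : (silt w : ℝ) = ∑ j ∈ Finset.range (n + 1), ∑ i ∈ Finset.range j,
      if walkPos w i = walkPos w j then (1 : ℝ) else 0 := by
    rw [silt, Finset.card_filter, Finset.sum_product_right]
    push_cast
    refine Finset.sum_congr rfl fun j hj => ?_
    rw [Finset.mem_range] at hj
    simp only [ite_and]
    rw [← Finset.sum_filter]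
    refine Finset.sum_congr ?_ fun _ _ => rfl
    ext i
    simp
    lia
  have hsum : ∑ w : Walk 1 n, (silt w : ℝ) =
      2 ^ n * ∑ j ∈ Finset.range (n + 1), ∑ i ∈ Finset.range j, returnProbAt (j - i) := by
    simp only [hsilt]
    rw [Finset.sum_comm, Finset.mul_sum]
    refine Finset.sum_congr rfl fun j hj => ?_
    rw [Finset.sum_comm, Finset.mul_sum]
    refine Finset.sum_congr rfl fun i hi => ?_
    rw [Finset.mem_range] at hi hj
    rw [Finset.sum_boole, card_walkPos_eq hi (by lia)]
  rw [E0, hsum, ← sum_returnProbAt_sub, Nat.cast_one, mul_one, mul_div_cancel_left₀]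
  positivity

theorem tendsto_sqrt_mul_returnProb :
    Tendsto (fun m : ℕ => √(2 * (m : ℝ) + 1) * returnProb m) atTop (nhds √(2 / Real.pi)) := by
  have hW (m : ℕ) : √(2 * (m : ℝ) + 1) * returnProb m = √(Real.Wallis.W m)⁻¹ := by
    have hfac : ((2 * m).factorial : ℝ) = m.centralBinom * m.factorial ^ 2 := by
      have h := Nat.choose_mul_factorial_mul_factorial (show m ≤ 2 * m by lia)
      rw [show 2 * m - m = m by lia, ← Nat.centralBinom_eq_two_mul_choose] at h
      rw [← h]
      push_cast
      ring
    have hc : (m.centralBinom : ℝ) ≠ 0 := by exact_mod_cast Nat.centralBinom_ne_zero m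
    have hf : (m.factorial : ℝ) ≠ 0 := by exact_mod_cast m.factorial_ne_zero
    have h4 : (2 : ℝ) ^ (4 * m) = (4 ^ m) ^ 2 := by
      rw [← pow_mul, show (4 : ℝ) = 2 ^ 2 by norm_num, ← pow_mul]
      congr 1
      ring
    have hinv : (Real.Wallis.W m)⁻¹ = (2 * m + 1) * returnProb m ^ 2 := by
      rw [Real.Wallis.W_eq_factorial_ratio, hfac, h4, returnProb]
      field_simp
    rw [hinv, Real.sqrt_mul (by positivity), Real.sqrt_sq (returnProb_nonneg m)]
  simp only [hW]
  rw [← inv_div]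
  exact ((Real.Wallis.tendsto_W_nhds_pi_div_two).inv₀ (by positivity)).sqrt

theorem tendsto_two_mul_half_div :
    Tendsto (fun n : ℕ => 2 * ((n / 2 : ℕ) : ℝ) / n) atTop (nhds 1) := by
  have hinv : Tendsto (fun n : ℕ => 1 - 1 / (n : ℝ)) atTop (nhds 1) := by
    simpa using tendsto_const_nhds.sub (tendsto_one_div_atTop_nhds_zero_nat (𝕜 := ℝ))
  refine tendsto_of_tendsto_of_tendsto_of_le_of_le' hinv tendsto_const_nhds ?_ ?_
  · filter_upwards [eventually_gt_atTop 0] with n hn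
    have hn' : (0 : ℝ) < n := by exact_mod_cast hn
    have h : (n : ℝ) ≤ 2 * ((n / 2 : ℕ) : ℝ) + 1 := by
      exact_mod_cast (by lia : n ≤ 2 * (n / 2) + 1)
    rw [le_div_iff₀ hn', sub_mul, one_div, inv_mul_cancel₀ hn'.ne']
    linarith
  · refine Eventually.of_forall fun n => div_le_one_of_le₀ ?_ (by positivity)
    exact_mod_cast (by lia : 2 * (n / 2) ≤ n)

/-- for the simple random walk in `ℤ` the expected
self-intersection local time satisfies `E₀(J_n) = (c + o(1)) n^{3/2}` for some
positive constant `c`. -/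
theorem srw_silt_one_dim :
    ∃ c : ℝ, 0 < c ∧
      Filter.Tendsto
        (fun n : ℕ => E0 1 n (fun w => (silt w : ℝ)) / (n : ℝ) ^ ((3 : ℝ) / 2))
        Filter.atTop (nhds c) := by
  refine ⟨√(2 / Real.pi) * √(1 + 0) * (1 + 0 - 1 / 3) - (1 + 0) * 0, ?_, ?_⟩
  · norm_num
    exact Real.pi_pos
  have hdiv : Tendsto (fun n : ℕ => n / 2) atTop atTop := Nat.tendsto_div_const_atTop two_ne_zero
  have hinv : Tendsto (fun n : ℕ => 1 / (n : ℝ)) atTop (nhds 0) :=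
    tendsto_one_div_atTop_nhds_zero_nat
  have hsqrt : Tendsto (fun n : ℕ => (√(n : ℝ))⁻¹) atTop (nhds 0) :=
    tendsto_inv_atTop_zero.comp (Real.tendsto_sqrt_atTop.comp tendsto_natCast_atTop_atTop)
  have hhalf := tendsto_two_mul_half_div
  have hmain := (((tendsto_sqrt_mul_returnProb.comp hdiv).mul (hhalf.add hinv).sqrt).mul
    ((hinv.const_add 1).sub (hhalf.div_const 3))).sub ((hinv.const_add 1).mul hsqrt)
  refine hmain.congr' ?_
  filter_upwards [eventually_gt_atTop 0] with n hn
  have hn' : (0 : ℝ) < n := by exact_mod_cast hn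
  have hpow : (n : ℝ) ^ ((3 : ℝ) / 2) = n * √n := by
    rw [show (3 : ℝ) / 2 = 1 + 1 / 2 by norm_num, Real.rpow_add hn', Real.rpow_one,
      ← Real.sqrt_eq_rpow]
  have hs : √(n : ℝ) ≠ 0 := (Real.sqrt_pos.2 hn').ne'
  have hm : √(2 * ((n / 2 : ℕ) : ℝ) + 1) ^ 2 = 2 * ((n / 2 : ℕ) : ℝ) + 1 :=
    Real.sq_sqrt (by positivity)
  rw [E0_silt_one, hpow, ← add_div, Real.sqrt_div (by positivity), Function.comp_apply]
  nth_rw 3 [← hm]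
  field_simp
end

section
/- Let β > 0 and d = 1. Then there exists a constant m₁(β) > 0 (which may depend on β) such that E_β(χ_n) = (1+o(1))·M₁(n)·n as n → ∞ for some sequence M₁(n) with m₁(β) ≤ M₁(n) ≤ 1; equivalently, m₁(β) ≤ liminf_{n→∞} E_β(χ_n)/n and limsup_{n→∞} E_β(χ_n)/n ≤ 1. In particular, the one-dimensional weakly self-avoiding walk is ballistic: its expected distance from the origin grows linearly in n. -/
open Filter

section IntegerSequences

/-- The number of pairs `i < j ≤ n` with `S i = S j`. -/
def selfIntersections (n : ℕ) (S : ℕ → ℤ) : ℕ :=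
  (((Finset.range (n + 1)) ×ˢ (Finset.range (n + 1))).filter
    (fun p => p.1 < p.2 ∧ S p.1 = S p.2)).card

/-- Discrete intermediate value theorem for an integer sequence with upward jumps at most one. -/
lemma exists_eq_of_le_of_le {S : ℕ → ℤ} {a b : ℕ} {x : ℤ} (hab : a ≤ b)
    (hS : ∀ i, a ≤ i → i < b → S (i + 1) ≤ S i + 1) (ha : S a ≤ x) (hb : x ≤ S b) :
    ∃ i, a ≤ i ∧ i ≤ b ∧ S i = x := by
  induction b, hab using Nat.le_induction with
  | base => exact ⟨a, le_rfl, le_rfl, le_antisymm ha hb⟩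
  | succ b hab ih =>
    by_cases h : x ≤ S b
    · obtain ⟨i, h1, h2, h3⟩ := ih (fun i h1 h2 => hS i h1 (by omega)) h
      exact ⟨i, h1, by omega, h3⟩
    · have := hS b hab (by omega)
      exact ⟨b + 1, by omega, le_rfl, by omega⟩

/-- The Cauchy–Schwarz lower bound for the number of self-intersections of a confined sequence. -/
lemma sq_le_of_confined {n K : ℕ} {S : ℕ → ℤ} (hS : ∀ i ≤ n, |S i| < 2 * K) :
    (n + 1) ^ 2 ≤ 4 * K * (2 * selfIntersections n S + (n + 1)) := by
  classical
  set R := Finset.range (n + 1) with hR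
  set T := Finset.Ioo (-(2 * K : ℤ)) (2 * K) with hT
  have hmap : ∀ i ∈ R, S i ∈ T := by
    intro i hi
    have := abs_lt.1 (hS i (by simp [hR] at hi; omega))
    simp [hT]; omega
  have hcard : T.card ≤ 4 * K := by
    simp [hT]; omega
  have h1 : R.card = ∑ x ∈ T, (R.filter (fun i => S i = x)).card :=
    Finset.card_eq_sum_card_fiberwise hmap
  have h2 : ((R ×ˢ R).filter (fun p => S p.1 = S p.2)).card
      = ∑ x ∈ T, (R.filter (fun i => S i = x)).card ^ 2 := by
    rw [Finset.card_eq_sum_card_fiberwise (f := fun p : ℕ × ℕ => S p.1) (t := T)]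
    · refine Finset.sum_congr rfl fun x _ => ?_
      rw [sq, ← Finset.card_product]
      congr 1
      ext ⟨i, j⟩
      simp only [Finset.mem_filter, Finset.mem_product]
      grind
    · intro p hp
      simp only [Finset.coe_filter, Finset.mem_product, Set.mem_ofPred_eq] at hp
      exact hmap _ hp.1.1
  have h3 : ((R ×ˢ R).filter (fun p => S p.1 = S p.2)).card
      ≤ 2 * selfIntersections n S + (n + 1) := by
    have hsub : (R ×ˢ R).filter (fun p => S p.1 = S p.2) ⊆
        ((R ×ˢ R).filter (fun p => p.1 < p.2 ∧ S p.1 = S p.2) ∪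
        ((R ×ˢ R).filter (fun p => p.1 < p.2 ∧ S p.1 = S p.2)).image Prod.swap) ∪
        R.image (fun i => (i, i)) := by
      rintro ⟨i, j⟩ h
      simp only [Finset.mem_union, Finset.mem_filter, Finset.mem_product, Finset.mem_image,
        Prod.exists, Prod.swap_prod_mk, Prod.mk.injEq] at h ⊢
      rcases lt_trichotomy i j with hij | hij | hij
      · exact Or.inl (Or.inl ⟨h.1, hij, h.2⟩)
      · exact Or.inr ⟨i, h.1.1, rfl, hij⟩
      · exact Or.inl (Or.inr ⟨j, i, ⟨⟨h.1.2, h.1.1⟩, hij, h.2.symm⟩, rfl, rfl⟩)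
    refine (Finset.card_le_card hsub).trans ?_
    refine (Finset.card_union_le _ _).trans ?_
    refine (Nat.add_le_add (Finset.card_union_le _ _) Finset.card_image_le).trans ?_
    have := Finset.card_image_le (s := (R ×ˢ R).filter (fun p => p.1 < p.2 ∧ S p.1 = S p.2))
      (f := Prod.swap)
    simp only [selfIntersections, ← hR]
    have hRc : R.card = n + 1 := by simp [hR]
    omega
  have h4 := sq_sum_le_card_mul_sum_sq (s := T) (f := fun x => (R.filter (fun i => S i = x)).card)
  rw [← h1, ← h2] at h4
  have hRc : R.card = n + 1 := by simp [hR]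
  rw [hRc] at h4
  exact h4.trans (Nat.mul_le_mul hcard h3)

/-- Reflecting a sequence at its first maximum removes all intersections between the two parts:
if the maximum is at least `2K` and the final value at most `K`, there are at least `K` of them. -/
lemma selfIntersections_reflect_add_le {n K t : ℕ} {S S' : ℕ → ℤ} (ht : t ≤ n) (h0 : S 0 = 0)
    (hup : ∀ i < n, S (i + 1) ≤ S i + 1) (hdown : ∀ i < n, S i ≤ S (i + 1) + 1)
    (hlt : ∀ i < t, S i < S t) (hle : ∀ i ≤ n, S i ≤ S t)
    (hmax : 2 * (K : ℤ) ≤ S t) (hend : S n ≤ K)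
    (hS1 : ∀ i ≤ t, S' i = S i) (hS2 : ∀ i, t ≤ i → i ≤ n → S' i = 2 * S t - S i) :
    selfIntersections n S' + K ≤ selfIntersections n S := by
  classical
  have hfirst : ∀ k : ℕ, ∃ i, k < K → i < t ∧ S i = K + k := by
    intro k
    by_cases hk : k < K
    · obtain ⟨i, -, h2, h3⟩ := exists_eq_of_le_of_le (S := S) (a := 0) (b := t) (x := K + k)
        (Nat.zero_le _) (fun i _ hi => hup i (by omega)) (by omega) (by omega)
      refine ⟨i, fun _ => ⟨lt_of_le_of_ne h2 ?_, h3⟩⟩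
      rintro rfl
      omega
    · exact ⟨0, fun h => absurd h hk⟩
  have hsecond : ∀ k : ℕ, ∃ j, k < K → t < j ∧ j ≤ n ∧ S j = K + k := by
    intro k
    by_cases hk : k < K
    · obtain ⟨j, h1, h2, h3⟩ := exists_eq_of_le_of_le (S := fun i => - S i) (a := t) (b := n)
        (x := -(K + k)) ht (fun i _ hi => by have := hdown i hi; omega) (by omega) (by omega)
      refine ⟨j, fun _ => ⟨lt_of_le_of_ne h1 ?_, h2, by omega⟩⟩
      rintro rfl
      omega
    · exact ⟨0, fun h => absurd h hk⟩
  choose f hf using hfirst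
  choose g hg using hsecond
  have hinj : Set.InjOn (fun k => (f k, g k)) (Finset.range K : Set ℕ) := by
    intro k hk l hl hkl
    simp only [Finset.coe_range, Set.mem_Iio] at hk hl
    have h1 := (hf k hk).2
    have h2 := (hf l hl).2
    have h3 : f k = f l := congrArg Prod.fst hkl
    rw [h3] at h1
    omega
  have hcard : ((Finset.range K).image (fun k => (f k, g k))).card = K := by
    rw [Finset.card_image_of_injOn hinj, Finset.card_range]
  have hcross : ∀ i j, i < t → t ≤ j → j ≤ n → S' i ≠ S' j := by
    intro i j hi hj hjn
    rw [hS1 i hi.le, hS2 j hj hjn]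
    have := hlt i hi
    have := hle j hjn
    omega
  unfold selfIntersections
  conv_lhs => rw [← hcard]
  rw [← Finset.card_union_of_disjoint]
  · refine Finset.card_le_card ?_
    rintro ⟨i, j⟩ h
    simp only [Finset.mem_union, Finset.mem_filter, Finset.mem_product, Finset.mem_image,
      Finset.mem_range, Prod.mk.injEq] at h ⊢
    rcases h with ⟨⟨hi, hj⟩, hij, h⟩ | ⟨k, hk, rfl, rfl⟩
    · refine ⟨⟨hi, hj⟩, hij, ?_⟩
      rcases lt_or_ge i t with hit | hit
      · rcases lt_or_ge j t with hjt | hjt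
        · rwa [hS1 i hit.le, hS1 j hjt.le] at h
        · exact absurd h (hcross i j hit hjt (by omega))
      · rw [hS2 i hit (by omega), hS2 j (by omega) (by omega)] at h
        omega
    · have h1 := hf k hk
      have h2 := hg k hk
      omega
  · rw [Finset.disjoint_left]
    rintro ⟨i, j⟩ h h'
    simp only [Finset.mem_filter, Finset.mem_product, Finset.mem_image,
      Finset.mem_range, Prod.mk.injEq] at h h'
    obtain ⟨k, hk, rfl, rfl⟩ := h'
    have h1 := hf k hk
    have h2 := hg k hk
    exact hcross _ _ h1.1 h2.1.le h2.2.1 h.2.2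

/-- A finite integer sequence attains its maximum at a first time. -/
lemma exists_first_max (S : ℕ → ℤ) (n : ℕ) :
    ∃ t ≤ n, (∀ i < t, S i < S t) ∧ ∀ i ≤ n, S i ≤ S t := by
  classical
  have hex : ∃ t, t ≤ n ∧ ∀ i ≤ n, S i ≤ S t := by
    obtain ⟨t, ht, h⟩ := Finset.exists_max_image (Finset.range (n + 1)) S ⟨0, by simp⟩
    exact ⟨t, by simp at ht; omega, fun i hi => h i (by simp; omega)⟩
  refine ⟨Nat.find hex, (Nat.find_spec hex).1, fun i hi => ?_, (Nat.find_spec hex).2⟩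
  have hn := (Nat.find_spec hex).1
  have hmax := (Nat.find_spec hex).2
  refine lt_of_le_of_ne (hmax i (by omega)) fun heq => ?_
  exact Nat.find_min hex hi ⟨by omega, fun j hj => heq ▸ hmax j hj⟩

end IntegerSequences

section OneDimensionalWalks

variable {n : ℕ}

/-- The integer position of a one-dimensional walk. -/
def linePos (w : Walk 1 n) (i : ℕ) : ℤ := walkPos w i 0

lemma linePos_zero (w : Walk 1 n) : linePos w 0 = 0 := by
  simp [linePos, walkPos]

lemma linePos_succ (w : Walk 1 n) {i : ℕ} (hi : i < n) :
    linePos w (i + 1) = linePos w i + (if (w ⟨i, hi⟩).2 then 1 else -1) := by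
  have hfil : Finset.filter (fun j : Fin n => (j : ℕ) < i + 1) Finset.univ
      = insert ⟨i, hi⟩ (Finset.filter (fun j : Fin n => (j : ℕ) < i) Finset.univ) := by
    ext j
    simp only [Finset.mem_filter, Finset.mem_univ, true_and, Finset.mem_insert, Fin.ext_iff]
    omega
  unfold linePos walkPos
  rw [hfil, Finset.sum_insert (by simp), add_comm]
  congr 1
  simp [stepVec, Subsingleton.elim (0 : Fin 1) (w ⟨i, hi⟩).1]

lemma linePos_succ_le (w : Walk 1 n) {i : ℕ} (hi : i < n) :
    linePos w (i + 1) ≤ linePos w i + 1 := by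
  rw [linePos_succ w hi]; split_ifs <;> omega

lemma linePos_le_succ (w : Walk 1 n) {i : ℕ} (hi : i < n) :
    linePos w i ≤ linePos w (i + 1) + 1 := by
  rw [linePos_succ w hi]; split_ifs <;> omega

lemma abs_linePos_le (w : Walk 1 n) {i : ℕ} (hi : i ≤ n) : |linePos w i| ≤ i := by
  induction i with
  | zero => simp [linePos_zero]
  | succ i ih =>
    have h1 := abs_le.1 (ih (by omega))
    have h2 := linePos_succ_le w (i := i) (by omega)
    have h3 := linePos_le_succ w (i := i) (by omega)
    rw [abs_le]; push_cast; omega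

lemma silt_eq_selfIntersections (w : Walk 1 n) : silt w = selfIntersections n (linePos w) := by
  unfold silt selfIntersections
  congr 1
  refine Finset.filter_congr fun p _ => ?_
  rw [funext_iff, Fin.forall_fin_one]
  rfl

lemma chi_eq_abs_linePos (w : Walk 1 n) : chi w = |(linePos w n : ℝ)| := by
  simp [chi, linePos, Real.sqrt_sq_eq_abs]

/-- Reverse all steps of a walk from time `t` on. -/
def reflectAfter (t : ℕ) (w : Walk 1 n) : Walk 1 n :=
  fun j => if (j : ℕ) < t then w j else ((w j).1, !(w j).2)

lemma reflectAfter_involutive (t : ℕ) : Function.Involutive (reflectAfter (n := n) t) := by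
  intro w
  funext j
  by_cases h : (j : ℕ) < t <;> simp [reflectAfter, h]

lemma linePos_reflectAfter_of_le (w : Walk 1 n) {t i : ℕ} (ht : t ≤ n) (hi : i ≤ t) :
    linePos (reflectAfter t w) i = linePos w i := by
  induction i with
  | zero => simp [linePos_zero]
  | succ i ih =>
    rw [linePos_succ _ (by omega : i < n), linePos_succ _ (by omega : i < n), ih (by omega)]
    simp [reflectAfter, show i < t by omega]

lemma linePos_reflectAfter_of_ge (w : Walk 1 n) {t i : ℕ} (hti : t ≤ i) (hi : i ≤ n) :
    linePos (reflectAfter t w) i = 2 * linePos w t - linePos w i := by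
  induction i, hti using Nat.le_induction with
  | base => rw [linePos_reflectAfter_of_le w hi le_rfl]; ring
  | succ i hti ih =>
    rw [linePos_succ _ (by omega : i < n), linePos_succ _ (by omega : i < n), ih (by omega)]
    simp only [reflectAfter, show ¬ i < t by omega, if_false]
    cases (w ⟨i, by omega⟩).2 <;> simp <;> ring

lemma linePos_reflectAfter_zero (w : Walk 1 n) {i : ℕ} (hi : i ≤ n) :
    linePos (reflectAfter 0 w) i = - linePos w i := by
  rw [linePos_reflectAfter_of_ge w (Nat.zero_le _) hi, linePos_zero]; ring

lemma silt_reflectAfter_zero (w : Walk 1 n) : silt (reflectAfter 0 w) = silt w := by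
  rw [silt_eq_selfIntersections, silt_eq_selfIntersections]
  unfold selfIntersections
  congr 1
  refine Finset.filter_congr fun p hp => ?_
  simp only [Finset.mem_product, Finset.mem_range] at hp
  rw [linePos_reflectAfter_zero w (by omega), linePos_reflectAfter_zero w (by omega), neg_inj]

lemma exists_silt_reflectAfter_add_le (w : Walk 1 n) {K : ℕ} (hend : linePos w n ≤ K)
    (hmax : ∃ i ≤ n, 2 * (K : ℤ) ≤ linePos w i) :
    ∃ t ≤ n, silt (reflectAfter t w) + K ≤ silt w := by
  obtain ⟨t, ht, hlt, hle⟩ := exists_first_max (linePos w) n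
  obtain ⟨i, hi, hiK⟩ := hmax
  refine ⟨t, ht, ?_⟩
  rw [silt_eq_selfIntersections, silt_eq_selfIntersections]
  exact selfIntersections_reflect_add_le ht (linePos_zero w) (fun _ => linePos_succ_le w)
    (fun _ => linePos_le_succ w) hlt hle (hiK.trans (hle i hi)) hend
    (fun _ => linePos_reflectAfter_of_le w ht) (fun _ => linePos_reflectAfter_of_ge w)

/-- A walk ending within distance `K` of the origin is confined, or else one of its reflections
has at least `K` fewer self-intersections. -/
lemma confined_or_exists_reflect (w : Walk 1 n) {K : ℕ} (hend : |linePos w n| ≤ K) :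
    (n + 1) ^ 2 ≤ 4 * K * (2 * silt w + (n + 1)) ∨
      ∃ t ≤ n, silt (reflectAfter t w) + K ≤ silt w ∨
        silt (reflectAfter t (reflectAfter 0 w)) + K ≤ silt w := by
  have hend' := abs_le.1 hend
  by_cases hup : ∃ i ≤ n, 2 * (K : ℤ) ≤ linePos w i
  · obtain ⟨t, ht, h⟩ := exists_silt_reflectAfter_add_le w hend'.2 hup
    exact Or.inr ⟨t, ht, Or.inl h⟩
  by_cases hdown : ∃ i ≤ n, 2 * (K : ℤ) ≤ - linePos w i
  · obtain ⟨t, ht, h⟩ := exists_silt_reflectAfter_add_le (reflectAfter 0 w) (K := K)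
      (by rw [linePos_reflectAfter_zero w le_rfl]; omega)
      (by
        obtain ⟨i, hi, h⟩ := hdown
        exact ⟨i, hi, by rwa [linePos_reflectAfter_zero w hi]⟩)
    rw [silt_reflectAfter_zero] at h
    exact Or.inr ⟨t, ht, Or.inr h⟩
  push Not at hup hdown
  left
  rw [silt_eq_selfIntersections]
  refine sq_le_of_confined fun i hi => ?_
  have := hup i hi
  have := hdown i hi
  rw [abs_lt]; omega

end OneDimensionalWalks

section Weights

variable {n : ℕ}

/-- The partition function of the one-dimensional weakly self-avoiding walk. -/
noncomputable def partitionFn (n : ℕ) (β : ℝ) : ℝ :=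
  ∑ w : Walk 1 n, Real.exp (-β * (silt w : ℝ))

lemma one_le_partitionFn (n : ℕ) (β : ℝ) : 1 ≤ partitionFn n β := by
  let w : Walk 1 n := fun _ => (0, true)
  have hpos : ∀ i ≤ n, linePos w i = i := by
    intro i hi
    induction i with
    | zero => simp [linePos_zero]
    | succ i ih => rw [linePos_succ w (by omega), ih (by omega)]; simp [w]
  have hsilt : silt w = 0 := by
    rw [silt_eq_selfIntersections, selfIntersections, Finset.card_eq_zero,
      Finset.filter_eq_empty_iff]
    rintro ⟨i, j⟩ hp ⟨hij, h⟩
    simp only [Finset.mem_product, Finset.mem_range] at hp hij h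
    rw [hpos i (by omega), hpos j (by omega)] at h
    omega
  calc (1 : ℝ) = Real.exp (-β * (silt w : ℝ)) := by simp [hsilt]
    _ ≤ _ := Finset.single_le_sum (f := fun w : Walk 1 n => Real.exp (-β * (silt w : ℝ)))
      (fun _ _ => (Real.exp_pos _).le) (Finset.mem_univ w)

lemma sum_exp_silt_comp {β : ℝ} {g : Walk 1 n → Walk 1 n} (hg : Function.Bijective g) :
    ∑ w : Walk 1 n, Real.exp (-β * (silt (g w) : ℝ)) = partitionFn n β :=
  hg.sum_comp (fun w => Real.exp (-β * (silt w : ℝ)))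

lemma exp_silt_le {β : ℝ} (hβ : 0 < β) {q K : ℕ} (hq : 8 ≤ β * (q - 4)) (hK : 0 < K)
    (hKn : q * K ≤ n) (w : Walk 1 n) (hend : |linePos w n| ≤ K) :
    Real.exp (-β * (silt w : ℝ)) ≤ Real.exp (-(n : ℝ)) +
      ∑ t ∈ Finset.range (n + 1), Real.exp (-β * K) *
        (Real.exp (-β * (silt (reflectAfter t w) : ℝ)) +
          Real.exp (-β * (silt (reflectAfter t (reflectAfter 0 w)) : ℝ))) := by
  rcases confined_or_exists_reflect w hend with h | ⟨t, ht, h⟩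
  · refine le_add_of_le_of_nonneg (Real.exp_le_exp.2 ?_)
      (Finset.sum_nonneg fun _ _ => by positivity)
    have h1 : ((n : ℝ) + 1) ^ 2 ≤ 4 * K * (2 * silt w + (n + 1)) := by exact_mod_cast h
    have h2 : (q : ℝ) * K ≤ n := by exact_mod_cast hKn
    have hK' : (0 : ℝ) < K := by exact_mod_cast hK
    have h3 : (q : ℝ) * (n + 1) ≤ 4 * (2 * silt w + (n + 1)) := by
      have : K * ((q : ℝ) * (n + 1)) ≤ K * (4 * (2 * silt w + (n + 1))) := by nlinarith
      exact le_of_mul_le_mul_left this hK'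
    have h4 : ((q : ℝ) - 4) * (n + 1) ≤ 8 * silt w := by linarith
    have h5 := mul_le_mul_of_nonneg_left h4 hβ.le
    have h6 : 8 * ((n : ℝ) + 1) ≤ β * (q - 4) * (n + 1) :=
      mul_le_mul_of_nonneg_right hq (by positivity)
    linarith
  · refine le_add_of_nonneg_of_le (Real.exp_pos _).le ?_
    refine le_trans ?_ (Finset.single_le_sum (fun _ _ => by positivity)
      (Finset.mem_range.2 (Nat.lt_succ_of_le ht)))
    have key : ∀ m : ℕ, m + K ≤ silt w →
        Real.exp (-β * (silt w : ℝ)) ≤ Real.exp (-β * K) * Real.exp (-β * (m : ℝ)) := by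
      intro m hm
      rw [← Real.exp_add, Real.exp_le_exp]
      have : (m : ℝ) + K ≤ silt w := by exact_mod_cast hm
      nlinarith
    rw [mul_add]
    rcases h with h | h
    · exact le_add_of_le_of_nonneg (key _ h) (by positivity)
    · exact le_add_of_nonneg_of_le (by positivity) (key _ h)

lemma le_Ewsaw_chi {β : ℝ} (hβ : 0 < β) {q K : ℕ} (hq : 8 ≤ β * (q - 4)) (hK : 0 < K)
    (hKn : q * K ≤ n) :
    (K : ℝ) * (1 - 2 ^ n * Real.exp (-(n : ℝ)) - 2 * (n + 1) * Real.exp (-β * K))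
      ≤ Ewsaw 1 n β chi := by
  have hZ := one_le_partitionFn n β
  have hK' : (0 : ℝ) < K := by exact_mod_cast hK
  have hpt : ∀ w : Walk 1 n, (K : ℝ) * (Real.exp (-β * (silt w : ℝ)) -
      (Real.exp (-(n : ℝ)) + ∑ t ∈ Finset.range (n + 1), Real.exp (-β * K) *
        (Real.exp (-β * (silt (reflectAfter t w) : ℝ)) +
          Real.exp (-β * (silt (reflectAfter t (reflectAfter 0 w)) : ℝ)))))
      ≤ Real.exp (-β * (silt w : ℝ)) * chi w := by
    intro w
    have hnn : 0 ≤ Real.exp (-β * (silt w : ℝ)) * chi w :=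
      mul_nonneg (Real.exp_pos _).le (Real.sqrt_nonneg _)
    by_cases hend : |linePos w n| ≤ K
    · have := exp_silt_le hβ hq hK hKn w hend
      exact (mul_nonpos_of_nonneg_of_nonpos hK'.le (by linarith)).trans hnn
    · have hchi : (K : ℝ) ≤ chi w := by
        rw [chi_eq_abs_linePos]
        push Not at hend
        exact_mod_cast hend.le
      rw [mul_comm (Real.exp _)]
      refine mul_le_mul hchi ?_ ?_ ?_ |>.trans' (mul_le_mul_of_nonneg_left
        (sub_le_self _ (by positivity)) hK'.le)
      · exact le_rfl
      · positivity
      · exact hK'.le.trans hchi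
  have hsum := Finset.sum_le_sum fun w (_ : w ∈ Finset.univ) => hpt w
  rw [← Finset.mul_sum, Finset.sum_sub_distrib, Finset.sum_add_distrib, Finset.sum_comm] at hsum
  simp only [← Finset.mul_sum, Finset.sum_add_distrib] at hsum
  have hr : ∀ t, ∑ w : Walk 1 n, Real.exp (-β * (silt (reflectAfter t w) : ℝ))
      = partitionFn n β := fun t => sum_exp_silt_comp (reflectAfter_involutive t).bijective
  have hr' : ∀ t, ∑ w : Walk 1 n,
      Real.exp (-β * (silt (reflectAfter t (reflectAfter 0 w)) : ℝ)) = partitionFn n β := fun t =>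
    sum_exp_silt_comp (g := fun w => reflectAfter t (reflectAfter 0 w))
      ((reflectAfter_involutive t).bijective.comp (reflectAfter_involutive 0).bijective)
  simp only [hr, hr'] at hsum
  have hcard : ∑ _w : Walk 1 n, Real.exp (-(n : ℝ)) = 2 ^ n * Real.exp (-(n : ℝ)) := by
    simp [Finset.card_univ]
  rw [hcard] at hsum
  simp only [Finset.sum_const, Finset.card_range, nsmul_eq_mul] at hsum
  change (K : ℝ) * (partitionFn n β - _) ≤ _ at hsum
  change _ ≤ _ / partitionFn n β
  rw [le_div_iff₀ (by linarith)]
  refine le_trans ?_ hsum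
  rw [mul_assoc]
  refine mul_le_mul_of_nonneg_left ?_ hK'.le
  have : 2 ^ n * Real.exp (-(n : ℝ)) ≤ 2 ^ n * Real.exp (-(n : ℝ)) * partitionFn n β :=
    le_mul_of_one_le_right (by positivity) hZ
  push_cast
  linarith

lemma Ewsaw_chi_nonneg (n : ℕ) (β : ℝ) : 0 ≤ Ewsaw 1 n β chi :=
  div_nonneg (Finset.sum_nonneg fun _ _ => mul_nonneg (Real.exp_pos _).le (Real.sqrt_nonneg _))
    (Finset.sum_nonneg fun _ _ => (Real.exp_pos _).le)

lemma Ewsaw_chi_le (n : ℕ) (β : ℝ) : Ewsaw 1 n β chi ≤ n := by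
  have hZ := one_le_partitionFn n β
  change _ / partitionFn n β ≤ _
  rw [div_le_iff₀ (by linarith), partitionFn, Finset.mul_sum]
  refine Finset.sum_le_sum fun w _ => ?_
  rw [mul_comm]
  refine mul_le_mul_of_nonneg_right ?_ (Real.exp_pos _).le
  rw [chi_eq_abs_linePos]
  exact_mod_cast abs_linePos_le w le_rfl

lemma tendsto_ballistic_error {β : ℝ} (hβ : 0 < β) {q : ℕ} (hq : 0 < q) :
    Tendsto (fun n : ℕ => 2 ^ n * Real.exp (-(n : ℝ)) +
      2 * ((n : ℝ) + 1) * Real.exp (-β * (n / q : ℕ))) atTop (nhds 0) := by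
  have h1 : Tendsto (fun n : ℕ => (2 : ℝ) ^ n * Real.exp (-(n : ℝ))) atTop (nhds 0) := by
    have : ∀ n : ℕ, (2 : ℝ) ^ n * Real.exp (-(n : ℝ)) = (2 * Real.exp (-1)) ^ n := by
      intro n
      rw [mul_pow, ← Real.exp_nat_mul]
      simp
    simp only [this]
    refine tendsto_pow_atTop_nhds_zero_of_lt_one (by positivity) ?_
    rw [Real.exp_neg, ← div_eq_mul_inv, div_lt_one (Real.exp_pos _)]
    linarith [Real.exp_one_gt_d9]
  have hgeom : Real.exp (-β) < 1 := Real.exp_lt_one_iff.2 (by linarith)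
  have h2 : Tendsto (fun k : ℕ => 2 * (q : ℝ) * ((k : ℝ) * Real.exp (-β) ^ k) +
      2 * (q + 1) * Real.exp (-β) ^ k) atTop (nhds 0) := by
    simpa using ((tendsto_self_mul_const_pow_of_lt_one (Real.exp_pos _).le hgeom).const_mul
      (2 * (q : ℝ))).add ((tendsto_pow_atTop_nhds_zero_of_lt_one (Real.exp_pos _).le
        hgeom).const_mul (2 * ((q : ℝ) + 1)))
  have h3 := h2.comp (Nat.tendsto_div_const_atTop hq.ne')
  have h4 : Tendsto (fun n : ℕ => 2 * ((n : ℝ) + 1) * Real.exp (-β * (n / q : ℕ)))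
      atTop (nhds 0) := by
    refine squeeze_zero (fun n => by positivity) (fun n => ?_) h3
    have hn : (n : ℝ) ≤ q * ((n / q : ℕ) + 1) := by
      exact_mod_cast (Nat.lt_mul_div_succ n hq).le
    have he : Real.exp (-β * (n / q : ℕ)) = Real.exp (-β) ^ (n / q) := by
      rw [← Real.exp_nat_mul, mul_comm]
    simp only [Function.comp, he]
    have := mul_le_mul_of_nonneg_right hn (pow_pos (Real.exp_pos (-β)) (n / q)).le
    linarith
  simpa using h1.add h4

end Weights

/-- the one-dimensional weakly self-avoiding walk is ballistic:
there is `m₁(β) > 0` with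
`m₁(β) ≤ liminf E_β(χ_n)/n` and `limsup E_β(χ_n)/n ≤ 1`. -/
theorem wsaw_one_dim_ballistic (β : ℝ) (hβ : 0 < β) :
    ∃ m₁ : ℝ, 0 < m₁ ∧
      m₁ ≤ Filter.liminf (fun n : ℕ => Ewsaw 1 n β chi / (n : ℝ)) Filter.atTop ∧
      Filter.limsup (fun n : ℕ => Ewsaw 1 n β chi / (n : ℝ)) Filter.atTop ≤ 1 := by
  obtain ⟨q, hq⟩ := exists_nat_ge (8 / β + 4)
  have hq8 : 8 ≤ β * ((q : ℝ) - 4) := by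
    rw [← div_le_iff₀' hβ]; linarith
  have hq0 : 0 < q := by
    have : (0 : ℝ) < q := lt_of_lt_of_le (by positivity) hq
    exact_mod_cast this
  have hq0' : (0 : ℝ) < q := by exact_mod_cast hq0
  have hupper : ∀ n : ℕ, Ewsaw 1 n β chi / (n : ℝ) ≤ 1 := fun n =>
    div_le_one_of_le₀ (Ewsaw_chi_le n β) (Nat.cast_nonneg n)
  have hlower : ∀ n : ℕ, 0 ≤ Ewsaw 1 n β chi / (n : ℝ) := fun n =>
    div_nonneg (Ewsaw_chi_nonneg n β) (Nat.cast_nonneg n)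
  refine ⟨1 / (4 * q), by positivity, ?_, ?_⟩
  · refine le_liminf_of_le
      (isBoundedUnder_of ⟨1, hupper⟩ : IsBoundedUnder (· ≤ ·) atTop _).isCoboundedUnder_ge ?_
    filter_upwards [(tendsto_ballistic_error hβ hq0).eventually_le_const
      (show (0 : ℝ) < 1 / 2 by norm_num), eventually_ge_atTop q] with n hn hqn
    have hn0 : (0 : ℝ) < n := by exact_mod_cast hq0.trans_le hqn
    have hK : 0 < n / q := Nat.div_pos hqn hq0
    have hE := le_Ewsaw_chi hβ hq8 hK (Nat.mul_div_le n q)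
    have hK1 : (1 : ℝ) ≤ (n / q : ℕ) := by exact_mod_cast hK
    have hnK : (n : ℝ) ≤ q * ((n / q : ℕ) + 1) := by
      exact_mod_cast (Nat.lt_mul_div_succ n hq0).le
    have hhalf : ((n / q : ℕ) : ℝ) * (1 / 2) ≤ Ewsaw 1 n β chi :=
      le_trans (mul_le_mul_of_nonneg_left (by linarith) (by positivity)) hE
    rw [div_le_div_iff₀ (by positivity) hn0]
    nlinarith
  · exact limsup_le_of_le
      (isBoundedUnder_of ⟨0, hlower⟩ : IsBoundedUnder (· ≥ ·) atTop _).isCoboundedUnder_le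
      (Eventually.of_forall hupper)
end
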